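/- Let U and V be real Banach spaces, A : U → V a continuous linear operator, and A* : V* → U* its dual operator, defined by (A* p*)(u) = p*(A u). Let E : V → ℝ ∪ {+∞} and G : U → ℝ ∪ {+∞} be proper, convex and lower semicontinuous. Assume there exists u₀ ∈ U such that E(A u₀) < +∞, G(u₀) < +∞ and E is continuous at A u₀, and assume that the primal value inf_{u ∈ U} ( E(Au) + G(u) ) is finite. Then inf_{u ∈ U} ( E(Au) + G(u) ) = sup_{p* ∈ V*} ( −E*(−p*) − G*(A* p*) ), and there exists p̄* ∈ V* attaining this supremum. -/

import Mathlib

noncomputable section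

/-- The convex conjugate (Legendre–Fenchel transform) of a function
`F : W → ℝ ∪ {+∞}` (encoded as `EReal`-valued), as a function on the
continuous dual `W →L[ℝ] ℝ`: `F*(w*) = sup_w (⟨w*, w⟩ − F(w))`. -/
def convexConj {W : Type*} [NormedAddCommGroup W] [NormedSpace ℝ W]
    (F : W → EReal) (p : W →L[ℝ] ℝ) : EReal :=
  ⨆ w : W, ((p w : EReal) - F w)

/-- Convexity for an `EReal`-valued function on a real vector space. -/
def IsConvexEReal {W : Type*} [AddCommGroup W] [Module ℝ W] (F : W → EReal) : Prop :=
  ∀ u v : W, ∀ a b : ℝ, 0 ≤ a → 0 ≤ b → a + b = 1 →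
    F (a • u + b • v) ≤ (a : EReal) * F u + (b : EReal) * F v

/-- The strict epigraph of the perturbation function `w ↦ inf_u (E (A u + w) + G u)`. -/
def perturbationEpigraph {U V : Type*}
    [NormedAddCommGroup U] [NormedSpace ℝ U] [NormedAddCommGroup V] [NormedSpace ℝ V]
    (A : U →L[ℝ] V) (E : V → EReal) (G : U → EReal) : Set (V × ℝ) :=
  {x | ∃ (u : U) (e g : ℝ), E (A u + x.1) ≤ e ∧ G u ≤ g ∧ e + g < x.2}

theorem IsConvexEReal.le_of_le {W : Type*} [AddCommGroup W] [Module ℝ W] {F : W → EReal}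
    (hF : IsConvexEReal F) {u v : W} {s t a b : ℝ} (hu : F u ≤ s) (hv : F v ≤ t)
    (ha : 0 ≤ a) (hb : 0 ≤ b) (hab : a + b = 1) :
    F (a • u + b • v) ≤ ((a * s + b * t : ℝ) : EReal) := by
  refine (hF u v a b ha hb hab).trans ?_
  push_cast
  exact add_le_add (mul_le_mul_of_nonneg_left hu (by exact_mod_cast ha))
    (mul_le_mul_of_nonneg_left hv (by exact_mod_cast hb))

section Duality

variable {U V : Type*}
  [NormedAddCommGroup U] [NormedSpace ℝ U] [NormedAddCommGroup V] [NormedSpace ℝ V]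
  {A : U →L[ℝ] V} {E : V → EReal} {G : U → EReal}

theorem convex_perturbationEpigraph (hE : IsConvexEReal E) (hG : IsConvexEReal G) :
    Convex ℝ (perturbationEpigraph A E G) := by
  rintro ⟨w₁, r₁⟩ ⟨u₁, e₁, g₁, hE₁, hG₁, h₁⟩ ⟨w₂, r₂⟩ ⟨u₂, e₂, g₂, hE₂, hG₂, h₂⟩ a b ha hb hab
  refine ⟨a • u₁ + b • u₂, a * e₁ + b * e₂, a * g₁ + b * g₂, ?_,
    hG.le_of_le hG₁ hG₂ ha hb hab, ?_⟩
  · convert hE.le_of_le hE₁ hE₂ ha hb hab using 2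
    simp only [map_add, map_smul, Prod.fst_add, Prod.smul_fst, smul_add]
    abel
  · simp only [Prod.snd_add, Prod.smul_snd, smul_eq_mul] at h₁ h₂ ⊢
    rcases ha.eq_or_lt with rfl | ha
    · obtain rfl : b = 1 := by linarith
      linarith
    · nlinarith [mul_lt_mul_of_pos_left h₁ ha, mul_le_mul_of_nonneg_left h₂.le hb]

theorem exists_mem_interior_perturbationEpigraph {u₀ : U} (hE0 : E (A u₀) ≠ ⊤) (hG0 : G u₀ ≠ ⊤)
    (hEcont : ContinuousAt E (A u₀)) :
    ∃ R : ℝ, ∀ r > R, ((0 : V), r) ∈ interior (perturbationEpigraph A E G) := by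
  obtain ⟨e, he, -⟩ := EReal.lt_iff_exists_real_btwn.1 (lt_top_iff_ne_top.2 hE0)
  obtain ⟨g, hg, -⟩ := EReal.lt_iff_exists_real_btwn.1 (lt_top_iff_ne_top.2 hG0)
  refine ⟨e + g, fun r hr => mem_interior_iff_mem_nhds.2 ?_⟩
  have hcont : ContinuousAt (fun w : V => E (A u₀ + w)) 0 := by
    apply ContinuousAt.comp
    · simpa using hEcont
    · fun_prop
  have hw : ∀ᶠ w in nhds (0 : V), E (A u₀ + w) < e := hcont.eventually_lt_const (by simpa using he)
  rw [nhds_prod_eq]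
  filter_upwards [hw.prod_mk (lt_mem_nhds hr)] with x hx
  exact ⟨u₀, e, g, hx.1.le, hg.le, hx.2⟩

/-- A subgradient at `0` of the perturbation function, with the sign changed. -/
theorem exists_dual_certificate (hE : IsConvexEReal E) (hG : IsConvexEReal G)
    {u₀ : U} (hE0 : E (A u₀) ≠ ⊤) (hG0 : G u₀ ≠ ⊤) (hEcont : ContinuousAt E (A u₀))
    {m : ℝ} (hm : ∀ u, (m : EReal) ≤ E (A u) + G u) :
    ∃ p : V →L[ℝ] ℝ, ∀ (u : U) (v : V) (e g : ℝ), E v ≤ e → G u ≤ g →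
      m ≤ e + p v + (g - p (A u)) := by
  set S := perturbationEpigraph A E G
  have hconv : Convex ℝ S := convex_perturbationEpigraph hE hG
  obtain ⟨R, hR⟩ := exists_mem_interior_perturbationEpigraph hE0 hG0 hEcont
  have hnot : ((0 : V), m) ∉ interior S := by
    intro h
    obtain ⟨u, e, g, hEu, hGu, hlt⟩ := interior_subset h
    rw [add_zero] at hEu
    have : (m : EReal) ≤ ((e + g : ℝ) : EReal) := by
      push_cast
      exact (hm u).trans (add_le_add hEu hGu)
    exact absurd (EReal.coe_le_coe_iff.1 this) (not_le.2 hlt)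
  obtain ⟨f, hf⟩ := geometric_hahn_banach_open_point hconv.interior isOpen_interior hnot
  have hle : ∀ x ∈ S, f x ≤ f (0, m) := by
    intro x hx
    have hx : x ∈ closure (interior S) := by
      rw [hconv.closure_interior_eq_closure_of_nonempty_interior ⟨_, hR (R + 1) (by linarith)⟩]
      exact subset_closure hx
    exact closure_minimal (fun y hy => (hf y hy).le)
      (isClosed_le f.continuous continuous_const) hx
  set q : V →L[ℝ] ℝ := f.comp (ContinuousLinearMap.inl ℝ V ℝ) with hq
  set c : ℝ := f (0, 1) with hc
  have hfx : ∀ w r, f (w, r) = q w + r * c := by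
    intro w r
    have : ((w, r) : V × ℝ) = (w, 0) + r • (0, 1) := by simp
    rw [this, map_add, map_smul]
    simp [hq, hc]
  have hc_neg : c < 0 := by
    have h := hf _ (hR (max R m + 1) (by linarith [le_max_left R m]))
    rw [hfx, hfx] at h
    simp only [map_zero, zero_add] at h
    nlinarith [le_max_right R m]
  refine ⟨c⁻¹ • q, fun u v e g hEv hGu => le_of_forall_pos_le_add fun ε hε => ?_⟩
  have h := hle (v - A u, e + g + ε) ⟨u, e, g, by simpa using hEv, hGu, by simpa using hε⟩
  rw [hfx, hfx] at h
  simp only [map_zero, zero_add, map_sub] at h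
  have h' := mul_le_mul_of_nonpos_left h (inv_lt_zero.2 hc_neg).le
  simp only [smul_apply, smul_eq_mul]
  have hc_ne : c ≠ 0 := hc_neg.ne
  have h₁ : c⁻¹ * (m * c) = m := by field_simp
  have h₂ : c⁻¹ * (q v - q (A u) + (e + g + ε) * c)
      = c⁻¹ * q v - c⁻¹ * q (A u) + (e + g + ε) := by field_simp
  linarith

theorem le_convexConj {W : Type*} [NormedAddCommGroup W] [NormedSpace ℝ W]
    (F : W → EReal) (p : W →L[ℝ] ℝ) (w : W) : (p w : EReal) - F w ≤ convexConj F p :=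
  le_iSup (fun w => (p w : EReal) - F w) w

theorem dual_le_primal (hE : ∀ v, E v ≠ ⊥) (hG : ∀ u, G u ≠ ⊥) (u : U) (p : V →L[ℝ] ℝ) :
    -(convexConj E (-p)) - convexConj G (p.comp A) ≤ E (A u) + G u := by
  have h₁ := le_convexConj E (-p) (A u)
  have h₂ := le_convexConj G (p.comp A) u
  rcases eq_or_ne (E (A u)) ⊤ with hEt | hEt
  · rw [hEt, EReal.top_add_of_ne_bot (hG u)]
    exact le_top
  rcases eq_or_ne (G u) ⊤ with hGt | hGt
  · rw [hGt, EReal.add_top_of_ne_bot (hE _)]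
    exact le_top
  lift E (A u) to ℝ using ⟨hEt, hE _⟩ with e
  lift G u to ℝ using ⟨hGt, hG _⟩ with g
  rw [sub_eq_add_neg]
  refine (add_le_add (EReal.neg_le_neg_iff.2 h₁) (EReal.neg_le_neg_iff.2 h₂)).trans (le_of_eq ?_)
  simp only [neg_apply, ContinuousLinearMap.comp_apply]
  norm_cast
  ring

theorem le_dual_of_certificate (hE : ∀ v, E v ≠ ⊥) (hG : ∀ u, G u ≠ ⊥)
    {u₀ : U} (hE0 : E (A u₀) ≠ ⊤) (hG0 : G u₀ ≠ ⊤) {m : ℝ} {p : V →L[ℝ] ℝ}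
    (hp : ∀ (u : U) (v : V) (e g : ℝ), E v ≤ e → G u ≤ g → m ≤ e + p v + (g - p (A u))) :
    (m : EReal) ≤ -(convexConj E (-p)) - convexConj G (p.comp A) := by
  have hbound : ∀ (u : U) (g : ℝ), G u ≤ g →
      convexConj E (-p) ≤ ((g - p (A u) - m : ℝ) : EReal) := by
    intro u g hg
    refine iSup_le fun v => ?_
    rcases eq_or_ne (E v) ⊤ with hEt | hEt
    · simp [hEt]
    have h := hp u v
    lift E v to ℝ using ⟨hEt, hE v⟩ with e
    have := h e g le_rfl hg
    simp only [neg_apply]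
    norm_cast
    linarith
  have hbot : convexConj E (-p) ≠ ⊥ := by
    have h := le_convexConj E (-p) (A u₀)
    lift E (A u₀) to ℝ using ⟨hE0, hE _⟩ with e
    exact ne_bot_of_le_ne_bot (EReal.coe_ne_bot (-p (A u₀) - e)) (by exact_mod_cast h)
  have htop : convexConj E (-p) ≠ ⊤ := by
    lift G u₀ to ℝ using ⟨hG0, hG _⟩ with g hg
    exact ne_top_of_le_ne_top (EReal.coe_ne_top _) (hbound u₀ g hg.ge)
  lift convexConj E (-p) to ℝ using ⟨htop, hbot⟩ with α
  have hconj : convexConj G (p.comp A) ≤ ((-α - m : ℝ) : EReal) := by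
    refine iSup_le fun u => ?_
    rcases eq_or_ne (G u) ⊤ with hGt | hGt
    · simp [hGt]
    have h := hbound u
    lift G u to ℝ using ⟨hGt, hG u⟩ with g
    have := EReal.coe_le_coe_iff.1 (h g le_rfl)
    simp only [ContinuousLinearMap.comp_apply]
    norm_cast
    linarith
  calc (m : EReal) = -(α : EReal) - ((-α - m : ℝ) : EReal) := by norm_cast; ring
    _ ≤ _ := EReal.sub_le_sub le_rfl hconj

end Duality

/-- **Fenchel–Rockafellar duality.** Let `U`, `V` be real Banach spaces,
`A : U → V` a continuous linear operator with dual `A* p* = p* ∘ A`, and let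
`E : V → ℝ ∪ {+∞}`, `G : U → ℝ ∪ {+∞}` be proper, convex and lower
semicontinuous. If there is `u₀` with `E(A u₀) < ∞`, `G(u₀) < ∞`, `E`
continuous at `A u₀`, and the primal value `inf_u (E(Au) + G(u))` is finite,
then `inf_u (E(Au) + G(u)) = sup_{p*} (−E*(−p*) − G*(A* p*))` and the
supremum is attained. -/
theorem fenchel_rockafellar_duality
    {U V : Type*}
    [NormedAddCommGroup U] [NormedSpace ℝ U] [CompleteSpace U]
    [NormedAddCommGroup V] [NormedSpace ℝ V] [CompleteSpace V]
    (A : U →L[ℝ] V) (E : V → EReal) (G : U → EReal)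
    (hEproper : ∃ v, E v ≠ ⊤) (hEnotbot : ∀ v, E v ≠ ⊥)
    (hGproper : ∃ u, G u ≠ ⊤) (hGnotbot : ∀ u, G u ≠ ⊥)
    (hEconv : IsConvexEReal E) (hGconv : IsConvexEReal G)
    (hElsc : LowerSemicontinuous E) (hGlsc : LowerSemicontinuous G)
    (u₀ : U) (hE0 : E (A u₀) ≠ ⊤) (hG0 : G u₀ ≠ ⊤)
    (hEcont : ContinuousAt E (A u₀))
    (hfin : ∃ m : ℝ, (⨅ u : U, (E (A u) + G u)) = (m : EReal)) :
    (⨅ u : U, (E (A u) + G u))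
      = (⨆ p : V →L[ℝ] ℝ, (-(convexConj E (-p)) - convexConj G (p.comp A))) ∧
    ∃ p : V →L[ℝ] ℝ,
      (-(convexConj E (-p)) - convexConj G (p.comp A))
        = (⨆ q : V →L[ℝ] ℝ, (-(convexConj E (-q)) - convexConj G (q.comp A))) := by
  obtain ⟨m, hm⟩ := hfin
  obtain ⟨p, hp⟩ := exists_dual_certificate hEconv hGconv hE0 hG0 hEcont
    (fun u => hm.ge.trans (iInf_le _ u))
  have hp := le_dual_of_certificate hEnotbot hGnotbot hE0 hG0 hp
  have hweak : ∀ q : V →L[ℝ] ℝ, -(convexConj E (-q)) - convexConj G (q.comp A)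
      ≤ ⨅ u : U, (E (A u) + G u) :=
    fun q => le_iInf fun u => dual_le_primal hEnotbot hGnotbot u q
  rw [← hm] at hp
  have hsup := le_iSup (fun q : V →L[ℝ] ℝ =>
    -(convexConj E (-q)) - convexConj G (q.comp A)) p
  exact ⟨le_antisymm (hp.trans hsup) (iSup_le hweak),
    p, le_antisymm hsup ((iSup_le hweak).trans hp)⟩
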